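/- Let H be a real Hilbert space and M ⊆ H × H a relation. Then M is m-accretive if and only if there exists a function f : H → H with ‖f(u) − f(x)‖ ≤ ‖u − x‖ for all u, x ∈ H such that for all u, v ∈ H: (u + v, u − v) ∈ M ⟺ v = f(u); equivalently, M = {(u + f(u), u − f(u)) : u ∈ H}. -/

import Mathlib

open RealInnerProductSpace

/-- A relation `M ⊆ H × H` is accretive if `⟪u - x, v - y⟫ ≥ 0` for all `(u, v), (x, y) ∈ M`. -/
def Accretive {H : Type*} [NormedAddCommGroup H] [InnerProductSpace ℝ H]
    (M : Set (H × H)) : Prop :=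
  ∀ p ∈ M, ∀ q ∈ M, 0 ≤ ⟪p.1 - q.1, p.2 - q.2⟫

/-- A relation `M ⊆ H × H` is m-accretive if it is accretive and `1 + M` is onto. -/
def MAccretive {H : Type*} [NormedAddCommGroup H] [InnerProductSpace ℝ H]
    (M : Set (H × H)) : Prop :=
  Accretive M ∧ ∀ f : H, ∃ p ∈ M, p.1 + p.2 = f

/-- The Cayley coordinates `(u + v, u - v)` turn the accretivity pairing into a difference of
squared norms. -/
theorem inner_add_sub_add_sub_sub_sub {H : Type*} [NormedAddCommGroup H] [InnerProductSpace ℝ H]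
    (u v x y : H) :
    ⟪u + v - (x + y), u - v - (x - y)⟫ = ‖u - x‖ ^ 2 - ‖v - y‖ ^ 2 := by
  have h₁ : u + v - (x + y) = (u - x) + (v - y) := by abel
  have h₂ : u - v - (x - y) = (u - x) - (v - y) := by abel
  rw [h₁, h₂, inner_sub_right, inner_add_left, inner_add_left, real_inner_self_eq_norm_sq,
    real_inner_self_eq_norm_sq, real_inner_comm (u - x) (v - y)]
  ring

/-- A relation `M ⊆ H × H` is m-accretive iff there is a function
`f : H → H` with `‖f u - f x‖ ≤ ‖u - x‖` for all `u, x` such that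
`(u + v, u - v) ∈ M ↔ v = f u` for all `u, v`; equivalently,
`M = {(u + f u, u - f u) : u ∈ H}`. -/
theorem stmt15 {H : Type*} [NormedAddCommGroup H] [InnerProductSpace ℝ H] [CompleteSpace H]
    (M : Set (H × H)) :
    MAccretive M ↔ ∃ f : H → H,
      (∀ u x : H, ‖f u - f x‖ ≤ ‖u - x‖) ∧
      (∀ u v : H, (u + v, u - v) ∈ M ↔ v = f u) ∧
      M = {q : H × H | ∃ u : H, q = (u + f u, u - f u)} := by
  constructor
  · rintro ⟨hacc, hsurj⟩
    have hex (u : H) : ∃ v : H, (u + v, u - v) ∈ M := by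
      obtain ⟨⟨a, b⟩, hM, hab⟩ := hsurj ((2 : ℝ) • u)
      refine ⟨a - u, ?_⟩
      have h₁ : u + (a - u) = a := by abel
      have h₂ : u - (a - u) = b := by
        rw [sub_sub_eq_add_sub, ← two_smul ℝ u, ← hab]
        exact add_sub_cancel_left a b
      rwa [h₁, h₂]
    choose f hf using hex
    have hle {u v x y : H} (h : (u + v, u - v) ∈ M) (h' : (x + y, x - y) ∈ M) :
        ‖v - y‖ ≤ ‖u - x‖ := by
      have := hacc _ h _ h'
      rw [inner_add_sub_add_sub_sub_sub, sub_nonneg] at this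
      exact le_of_sq_le_sq this (norm_nonneg _)
    have hiff (u v : H) : (u + v, u - v) ∈ M ↔ v = f u := by
      refine ⟨fun h ↦ ?_, fun h ↦ h ▸ hf u⟩
      simpa [sub_eq_zero] using hle h (hf u)
    refine ⟨f, fun u x ↦ hle (hf u) (hf x), hiff, ?_⟩
    ext ⟨a, b⟩
    constructor
    · intro h
      have h₁ : (2⁻¹ : ℝ) • (a + b) + (2⁻¹ : ℝ) • (a - b) = a := by module
      have h₂ : (2⁻¹ : ℝ) • (a + b) - (2⁻¹ : ℝ) • (a - b) = b := by module
      refine ⟨(2⁻¹ : ℝ) • (a + b), ?_⟩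
      rw [← (hiff ((2⁻¹ : ℝ) • (a + b)) ((2⁻¹ : ℝ) • (a - b))).1 (by rwa [h₁, h₂]), h₁, h₂]
    · rintro ⟨u, hu⟩
      exact hu ▸ hf u
  · rintro ⟨f, hlip, -, rfl⟩
    refine ⟨?_, fun g ↦ ⟨_, ⟨(2⁻¹ : ℝ) • g, rfl⟩, ?_⟩⟩
    · rintro _ ⟨u, rfl⟩ _ ⟨x, rfl⟩
      rw [inner_add_sub_add_sub_sub_sub, sub_nonneg]
      exact pow_le_pow_left₀ (norm_nonneg _) (hlip u x) 2
    · module
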